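/- There are no II-minimal translation surfaces in Euclidean 3-space: there do not exist open intervals I, J ⊆ ℝ and smooth functions α : I → ℝ, β : J → ℝ with α'(u) ≠ 0 for all u ∈ I and β'(v) ≠ 0 for all v ∈ J such that for all (u,v) ∈ I × J: (2α'α''' − 3α''²)/(2α'³) + (2β'β''' − 3β''²)/(2β'³) − (2/Δ)·((α'² + αα'')/α' + (β'² + ββ'')/β') + (6/Δ²)·(α²α' + β²β') = 0, where Δ = 1 + α(u)² + β(v)². -/

import Mathlib

open Filter Topology

/-- A function with nonzero derivative at `x` takes infinitely many values near `x`. -/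
theorem HasDerivAt.infinite_image_of_ne_zero {f : ℝ → ℝ} {f' x : ℝ} {U : Set ℝ}
    (hf : HasDerivAt f f' x) (hf' : f' ≠ 0) (hU : U ∈ 𝓝 x) : (f '' U).Infinite := by
  intro hfin
  have hne : ∀ᶠ z in 𝓝[≠] x, ∀ c ∈ f '' U, f z ≠ c :=
    (eventually_all_finite hfin).2 fun c _ => hf.eventually_ne hf'
  obtain ⟨z, hz, hzU⟩ := (hne.and (mem_nhdsWithin_of_mem_nhds hU)).exists
  exact hz _ ⟨z, hzU, rfl⟩ rfl

open Polynomial in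
/-- A real quartic with infinitely many roots has zero coefficients. -/
theorem quartic_coeffs_eq_zero_of_infinite {T : Set ℝ} (hT : T.Infinite) {c₀ c₁ c₂ c₃ c₄ : ℝ}
    (h : ∀ s ∈ T, c₀ + c₁ * s + c₂ * s ^ 2 + c₃ * s ^ 3 + c₄ * s ^ 4 = 0) :
    c₀ = 0 ∧ c₁ = 0 ∧ c₂ = 0 ∧ c₃ = 0 ∧ c₄ = 0 := by
  have hp : (C c₀ + C c₁ * X + C c₂ * X ^ 2 + C c₃ * X ^ 3 + C c₄ * X ^ 4 : ℝ[X]) = 0 := by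
    refine eq_zero_of_infinite_isRoot _ (hT.mono fun s hs => ?_)
    simpa [IsRoot.def] using h s hs
  have hc := fun n => congrArg (fun q => coeff q n) hp
  exact ⟨by simpa [coeff_X, coeff_X_pow, coeff_C] using hc 0,
    by simpa [coeff_X, coeff_X_pow, coeff_C] using hc 1,
    by simpa [coeff_X, coeff_X_pow, coeff_C] using hc 2,
    by simpa [coeff_X, coeff_X_pow, coeff_C] using hc 3,
    by simpa [coeff_X, coeff_X_pow, coeff_C] using hc 4⟩

/-- The coefficients of a quadratic are fixed linear combinations of its values at three
distinct points. -/
theorem exists_quadratic_interpolation_weights {x y z : ℝ} (hxy : x ≠ y) (hxz : x ≠ z)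
    (hyz : y ≠ z) : ∃ w : Fin 3 → Fin 3 → ℝ, ∀ (a : Fin 3 → ℝ) (j : Fin 3),
      a j = w j 0 * (a 0 + a 1 * x + a 2 * x ^ 2) + w j 1 * (a 0 + a 1 * y + a 2 * y ^ 2)
        + w j 2 * (a 0 + a 1 * z + a 2 * z ^ 2) := by
  have h₁ := sub_ne_zero.2 hxy
  have h₂ := sub_ne_zero.2 hxz
  have h₃ := sub_ne_zero.2 hyz
  refine ⟨![![y * z / ((x - y) * (x - z)), -(x * z) / ((x - y) * (y - z)),
      x * y / ((x - z) * (y - z))],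
    ![-(y + z) / ((x - y) * (x - z)), (x + z) / ((x - y) * (y - z)),
      -(x + y) / ((x - z) * (y - z))],
    ![1 / ((x - y) * (x - z)), -1 / ((x - y) * (y - z)), 1 / ((x - z) * (y - z))]], ?_⟩
  intro a j
  fin_cases j <;> simp <;> field_simp <;> ring

/-- A function on a product that is quadratic in `t v` for each `u` and quadratic in `s u` for
each `v` is biquadratic in `(s u, t v)`. -/
theorem exists_biquadratic_coeffs {U V : Set ℝ} {s t : ℝ → ℝ} {M N : Fin 3 → ℝ → ℝ}
    (hU : (s '' U).Infinite) (hV : (t '' V).Infinite)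
    (h : ∀ u ∈ U, ∀ v ∈ V, M 0 u + M 1 u * t v + M 2 u * t v ^ 2
      = N 0 v + N 1 v * s u + N 2 v * s u ^ 2) :
    ∃ m : Fin 3 → Fin 3 → ℝ,
      (∀ u ∈ U, ∀ j, M j u = m 0 j + m 1 j * s u + m 2 j * s u ^ 2) ∧
      (∀ v ∈ V, ∀ i, N i v = m i 0 + m i 1 * t v + m i 2 * t v ^ 2) := by
  obtain ⟨_, a, ha, rfl⟩ := hV.nonempty
  obtain ⟨_, ⟨b, hb, rfl⟩, hy⟩ := hV.exists_notMem_finite (Set.finite_singleton (t a))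
  obtain ⟨_, ⟨c, hc, rfl⟩, hz⟩ := hV.exists_notMem_finite (Set.toFinite {t a, t b})
  simp only [Set.mem_insert_iff, Set.mem_singleton_iff, not_or] at hy hz
  obtain ⟨w, hw⟩ := exists_quadratic_interpolation_weights (Ne.symm hy) (Ne.symm hz.1)
    (Ne.symm hz.2)
  set m : Fin 3 → Fin 3 → ℝ := fun i j => w j 0 * N i a + w j 1 * N i b + w j 2 * N i c with hm
  have hM : ∀ u ∈ U, ∀ j, M j u = m 0 j + m 1 j * s u + m 2 j * s u ^ 2 := by
    intro u hu j
    have := hw (fun i => M i u) j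
    simp only [h u hu a ha, h u hu b hb, h u hu c hc] at this
    rw [this, hm]
    ring
  refine ⟨m, hM, fun v hv i => ?_⟩
  have hN := quartic_coeffs_eq_zero_of_infinite hU
    (c₀ := m 0 0 + m 0 1 * t v + m 0 2 * t v ^ 2 - N 0 v)
    (c₁ := m 1 0 + m 1 1 * t v + m 1 2 * t v ^ 2 - N 1 v)
    (c₂ := m 2 0 + m 2 1 * t v + m 2 2 * t v ^ 2 - N 2 v) (c₃ := 0) (c₄ := 0) (by
      rintro _ ⟨u, hu, rfl⟩
      have := h u hu v hv
      rw [hM u hu 0, hM u hu 1, hM u hu 2] at this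
      linear_combination this)
  fin_cases i
  · exact (sub_eq_zero.1 hN.1).symm
  · exact (sub_eq_zero.1 hN.2.1).symm
  · exact (sub_eq_zero.1 hN.2.2.1).symm

/-- If `α² α'` and `(α α')' / α'` are polynomials in `α²`, the former determines the latter. -/
theorem coeffs_relation_of_polynomial_in_sq {U : Set ℝ} {α : ℝ → ℝ} (hU : IsOpen U)
    (hα : ContDiffOn ℝ (⊤ : ℕ∞) α U) (h₁ : ∀ u ∈ U, deriv α u ≠ 0)
    (hinf : ((fun u => α u ^ 2) '' U).Infinite) {c₀ c₁ c₂ c₃ c₄ d₀ d₁ d₂ d₃ : ℝ}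
    (hc : ∀ u ∈ U, 6 * (α u ^ 2 * deriv α u) = c₀ + c₁ * α u ^ 2 + c₂ * (α u ^ 2) ^ 2
      + c₃ * (α u ^ 2) ^ 3 + c₄ * (α u ^ 2) ^ 4)
    (hd : ∀ u ∈ U, 2 * ((deriv α u ^ 2 + α u * deriv (deriv α) u) / deriv α u)
      = d₀ + d₁ * α u ^ 2 + d₂ * (α u ^ 2) ^ 2 + d₃ * (α u ^ 2) ^ 3) :
    c₀ = 0 ∧ c₁ = 3 * d₀ ∧ c₂ = d₁ ∧ 5 * c₃ = 3 * d₂ ∧ 7 * c₄ = 3 * d₃ := by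
  have key := quartic_coeffs_eq_zero_of_infinite hinf (c₀ := -c₀) (c₁ := c₁ - 3 * d₀)
    (c₂ := 3 * c₂ - 3 * d₁) (c₃ := 5 * c₃ - 3 * d₂) (c₄ := 7 * c₄ - 3 * d₃) (by
      rintro _ ⟨u, hu, rfl⟩
      have hUu := hU.mem_nhds hu
      have hα₁ : HasDerivAt α (deriv α u) u :=
        ((hα.contDiffAt hUu).differentiableAt (by simp)).hasDerivAt
      have hα₂ : HasDerivAt (deriv α) (deriv (deriv α) u) u :=
        (((hα.deriv_of_isOpen (m := (⊤ : ℕ∞)) hU (by simp)).contDiffAt hUu).differentiableAt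
          (by simp)).hasDerivAt
      have hs := hα₁.fun_pow 2
      have hl := (hs.fun_mul hα₂).const_mul 6
      have hr := ((((hs.const_mul c₁).const_add c₀).fun_add ((hs.fun_pow 2).const_mul c₂)).fun_add
        ((hs.fun_pow 3).const_mul c₃)).fun_add ((hs.fun_pow 4).const_mul c₄)
      have he := hl.unique (hr.congr_of_eventuallyEq
        (Filter.eventuallyEq_of_mem hUu fun x hx => hc x hx))
      have hcu := hc u hu
      have hdu := hd u hu
      have hp := h₁ u hu
      rw [mul_div_assoc', div_eq_iff hp] at hdu
      push_cast at he
      apply mul_left_cancel₀ hp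
      linear_combination (-α u) * he + deriv α u * hcu + 3 * α u ^ 2 * hdu)
  refine ⟨?_, ?_, ?_, ?_, ?_⟩ <;> linarith [key.1, key.2.1, key.2.2.1, key.2.2.2.1, key.2.2.2.2]

/-- If `α' = r (1 + α²)`, the expression `(2 α' α''' - 3 α''²) / (2 α'³)` is constant only for
`r = 0`. -/
theorem eq_zero_of_deriv_eq_mul_one_add_sq {U : Set ℝ} {α : ℝ → ℝ} {r b : ℝ} (hU : IsOpen U)
    (hα : ContDiffOn ℝ (⊤ : ℕ∞) α U) (h₁ : ∀ u ∈ U, deriv α u ≠ 0)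
    (hinf : ((fun u => α u ^ 2) '' U).Infinite)
    (hr : ∀ u ∈ U, deriv α u = r * (1 + α u ^ 2))
    (hb : ∀ u ∈ U, (2 * deriv α u * deriv (deriv (deriv α)) u - 3 * deriv (deriv α) u ^ 2) /
      (2 * deriv α u ^ 3) = b) : r = 0 := by
  have hα₁ : ∀ u ∈ U, HasDerivAt α (deriv α u) u := fun u hu =>
    ((hα.contDiffAt (hU.mem_nhds hu)).differentiableAt (by simp)).hasDerivAt
  have hd₂ : ∀ u ∈ U, deriv (deriv α) u = 2 * r * α u * deriv α u := by
    intro u hu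
    have he : deriv α =ᶠ[𝓝 u] fun x => r * (1 + α x ^ 2) :=
      Filter.eventuallyEq_of_mem (hU.mem_nhds hu) hr
    rw [he.deriv_eq, ((((hα₁ u hu).fun_pow 2).const_add 1).const_mul r).deriv]
    push_cast
    ring
  have hd₃ : ∀ u ∈ U, deriv (deriv (deriv α)) u
      = 2 * r * (deriv α u ^ 2 + α u * deriv (deriv α) u) := by
    intro u hu
    have hα₂ : HasDerivAt (deriv α) (deriv (deriv α) u) u :=
      (((hα.deriv_of_isOpen (m := (⊤ : ℕ∞)) hU (by simp)).contDiffAt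
        (hU.mem_nhds hu)).differentiableAt (by simp)).hasDerivAt
    have he : deriv (deriv α) =ᶠ[𝓝 u] fun x => 2 * r * α x * deriv α x :=
      Filter.eventuallyEq_of_mem (hU.mem_nhds hu) hd₂
    rw [he.deriv_eq, (((hα₁ u hu).const_mul (2 * r)).fun_mul hα₂).deriv]
    ring
  have key := quartic_coeffs_eq_zero_of_infinite hinf (c₀ := 2 * r ^ 2 - b * r) (c₁ := -(b * r))
    (c₂ := 0) (c₃ := 0) (c₄ := 0) (by
      rintro _ ⟨u, hu, rfl⟩
      have h := hb u hu
      have hp := h₁ u hu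
      rw [hd₃ u hu, hd₂ u hu, div_eq_iff (by positivity)] at h
      have hru := hr u hu
      generalize deriv α u = p at h hp hru
      apply mul_left_cancel₀ (pow_ne_zero 2 hp)
      linear_combination h / 2 - (2 * r * p ^ 2 - b * p ^ 2) * hru)
  nlinarith [key.1, key.2.1]

/-- A smooth function with nowhere vanishing derivative on a nonempty open set restricts to an
open set on which it does not vanish and its square takes infinitely many values. -/
theorem exists_isOpen_subset_ne_zero_infinite_sq {I : Set ℝ} {α : ℝ → ℝ} (hI : IsOpen I)
    (hne : I.Nonempty) (hα : ContDiffOn ℝ (⊤ : ℕ∞) α I) (h₁ : ∀ u ∈ I, deriv α u ≠ 0) :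
    ∃ U ⊆ I, IsOpen U ∧ (∀ u ∈ U, α u ≠ 0) ∧ ((fun u => α u ^ 2) '' U).Infinite := by
  have hd : ∀ u ∈ I, HasDerivAt α (deriv α u) u := fun u hu =>
    ((hα.contDiffAt (hI.mem_nhds hu)).differentiableAt (by simp)).hasDerivAt
  have hopen : IsOpen (I ∩ α ⁻¹' {0}ᶜ) :=
    hα.continuousOn.isOpen_inter_preimage hI isOpen_compl_singleton
  obtain ⟨w, hw⟩ := hne
  obtain ⟨u, hu0, huI⟩ := (((hd w hw).eventually_ne (c := 0) (h₁ w hw)).and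
    (mem_nhdsWithin_of_mem_nhds (hI.mem_nhds hw))).exists
  refine ⟨I ∩ α ⁻¹' {0}ᶜ, Set.inter_subset_left, hopen, fun u hu => hu.2, ?_⟩
  refine ((hd u huI).fun_pow 2).infinite_image_of_ne_zero ?_ (hopen.mem_nhds ⟨huI, hu0⟩)
  simpa using ⟨hu0, h₁ u huI⟩


/-- There are no II-minimal translation surfaces in Euclidean 3-space: there are
no smooth functions `α = f'`, `β = g'` on (nonempty) open intervals, with nowhere
vanishing derivatives, satisfying the equation equivalent to `H_II = 0`. -/
theorem stmt_12 :
    ¬ ∃ (I J : Set ℝ) (α β : ℝ → ℝ),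
      IsOpen I ∧ Convex ℝ I ∧ I.Nonempty ∧
      IsOpen J ∧ Convex ℝ J ∧ J.Nonempty ∧
      ContDiffOn ℝ (⊤ : ℕ∞) α I ∧ ContDiffOn ℝ (⊤ : ℕ∞) β J ∧
      (∀ u ∈ I, deriv α u ≠ 0) ∧ (∀ v ∈ J, deriv β v ≠ 0) ∧
      (∀ u ∈ I, ∀ v ∈ J,
        (2 * deriv α u * deriv (deriv (deriv α)) u - 3 * deriv (deriv α) u ^ 2) /
            (2 * deriv α u ^ 3)
          + (2 * deriv β v * deriv (deriv (deriv β)) v - 3 * deriv (deriv β) v ^ 2) /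
            (2 * deriv β v ^ 3)
          - 2 / (1 + α u ^ 2 + β v ^ 2) *
            ((deriv α u ^ 2 + α u * deriv (deriv α) u) / deriv α u
              + (deriv β v ^ 2 + β v * deriv (deriv β) v) / deriv β v)
          + 6 / (1 + α u ^ 2 + β v ^ 2) ^ 2 *
            (α u ^ 2 * deriv α u + β v ^ 2 * deriv β v) = 0) := by
  rintro ⟨I, J, α, β, hI, -, hIne, hJ, -, hJne, hα, hβ, hα₁, hβ₁, h⟩
  obtain ⟨U, hUI, hU, hα₀, hUinf⟩ := exists_isOpen_subset_ne_zero_infinite_sq hI hIne hα hα₁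
  obtain ⟨V, hVJ, hV, hβ₀, hVinf⟩ := exists_isOpen_subset_ne_zero_infinite_sq hJ hJne hβ hβ₁
  replace hα := hα.mono hUI
  replace hβ := hβ.mono hVJ
  replace hα₁ : ∀ u ∈ U, deriv α u ≠ 0 := fun u hu => hα₁ u (hUI hu)
  replace hβ₁ : ∀ v ∈ V, deriv β v ≠ 0 := fun v hv => hβ₁ v (hVJ hv)
  let A (γ : ℝ → ℝ) (u : ℝ) : ℝ :=
    (2 * deriv γ u * deriv (deriv (deriv γ)) u - 3 * deriv (deriv γ) u ^ 2) / (2 * deriv γ u ^ 3)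
  let P (γ : ℝ → ℝ) (u : ℝ) : ℝ := (deriv γ u ^ 2 + γ u * deriv (deriv γ) u) / deriv γ u
  let M (γ : ℝ → ℝ) : Fin 3 → ℝ → ℝ := ![
    fun u => (1 + γ u ^ 2) ^ 2 * A γ u - 2 * (1 + γ u ^ 2) * P γ u + 6 * (γ u ^ 2 * deriv γ u),
    fun u => 2 * (1 + γ u ^ 2) * A γ u - 2 * P γ u, A γ]
  have hR : ∀ γ u, 6 * (γ u ^ 2 * deriv γ u)
      = M γ 0 u - (1 + γ u ^ 2) * M γ 1 u + (1 + γ u ^ 2) ^ 2 * M γ 2 u := by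
    intro γ u
    simp only [M, Matrix.cons_val]
    ring
  have hP : ∀ γ u, 2 * P γ u = 2 * (1 + γ u ^ 2) * M γ 2 u - M γ 1 u := by
    intro γ u
    simp only [M, Matrix.cons_val]
    ring
  have hsep : ∀ u ∈ U, ∀ v ∈ V, M α 0 u + M α 1 u * β v ^ 2 + M α 2 u * (β v ^ 2) ^ 2
      = -M β 0 v + -M β 1 v * α u ^ 2 + -M β 2 v * (α u ^ 2) ^ 2 := by
    intro u hu v hv
    have hΔ : 1 + α u ^ 2 + β v ^ 2 ≠ 0 := by positivity
    have he : A α u + A β v - 2 / (1 + α u ^ 2 + β v ^ 2) * (P α u + P β v)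
        + 6 / (1 + α u ^ 2 + β v ^ 2) ^ 2 * (α u ^ 2 * deriv α u + β v ^ 2 * deriv β v) = 0 :=
      h u (hUI hu) v (hVJ hv)
    simp only [M, Matrix.cons_val]
    generalize A α u = a at *
    generalize A β v = b at *
    generalize P α u = p at *
    generalize P β v = q at *
    field_simp at he
    linear_combination he
  obtain ⟨m, hm, hn⟩ := exists_biquadratic_coeffs (M := M α) (N := fun i v => -M β i v)
    hUinf hVinf hsep
  replace hn : ∀ v ∈ V, ∀ i, M β i v = -(m i 0 + m i 1 * β v ^ 2 + m i 2 * (β v ^ 2) ^ 2) :=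
    fun v hv i => by rw [← hn v hv i, neg_neg]
  obtain ⟨e₀, e₁, e₂, e₃, e₄⟩ := coeffs_relation_of_polynomial_in_sq hU hα hα₁ hUinf
    (c₀ := m 0 0 - m 0 1 + m 0 2)
    (c₁ := m 1 0 - m 1 1 - m 0 1 + m 1 2 + 2 * m 0 2)
    (c₂ := m 2 0 - m 2 1 - m 1 1 + m 2 2 + 2 * m 1 2 + m 0 2)
    (c₃ := -m 2 1 + 2 * m 2 2 + m 1 2) (c₄ := m 2 2)
    (d₀ := 2 * m 0 2 - m 0 1) (d₁ := 2 * m 1 2 + 2 * m 0 2 - m 1 1)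
    (d₂ := 2 * m 2 2 + 2 * m 1 2 - m 2 1) (d₃ := 2 * m 2 2)
    (fun u hu => by rw [hR α u, hm u hu, hm u hu, hm u hu]; ring)
    (fun u hu => by refine (hP α u).trans ?_; rw [hm u hu, hm u hu]; ring)
  obtain ⟨f₀, f₁, f₂, f₃, f₄⟩ := coeffs_relation_of_polynomial_in_sq hV hβ hβ₁ hVinf
    (c₀ := -(m 0 0 - m 1 0 + m 2 0))
    (c₁ := -(m 0 1 - m 1 1 - m 1 0 + m 2 1 + 2 * m 2 0))
    (c₂ := -(m 0 2 - m 1 2 - m 1 1 + m 2 2 + 2 * m 2 1 + m 2 0))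
    (c₃ := -(-m 1 2 + 2 * m 2 2 + m 2 1)) (c₄ := -m 2 2)
    (d₀ := -(2 * m 2 0 - m 1 0)) (d₁ := -(2 * m 2 1 + 2 * m 2 0 - m 1 1))
    (d₂ := -(2 * m 2 2 + 2 * m 2 1 - m 1 2)) (d₃ := -(2 * m 2 2))
    (fun v hv => by rw [hR β v, hn v hv, hn v hv, hn v hv]; ring)
    (fun v hv => by refine (hP β v).trans ?_; rw [hn v hv, hn v hv]; ring)
  have h₂₂ : m 2 2 = 0 := by linarith
  have h₁₂ : m 1 2 = 0 := by linarith
  have h₂₁ : m 2 1 = 0 := by linarith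
  have h₂₀ : m 2 0 = m 0 2 := by linarith
  have hr : ∀ u ∈ U, deriv α u = (2 * m 0 2 - m 1 1) / 6 * (1 + α u ^ 2) := by
    intro u hu
    have h₆ := hR α u
    rw [hm u hu, hm u hu, hm u hu, h₂₂, h₁₂, h₂₁, h₂₀] at h₆
    have h₁₀ : m 1 0 = m 0 1 := by linarith
    apply mul_left_cancel₀ (pow_ne_zero 2 (hα₀ u hu))
    linear_combination h₆ / 6 + e₀ / 6 + α u ^ 2 / 6 * h₁₀
  have hr₀ := eq_zero_of_deriv_eq_mul_one_add_sq hU hα hα₁ hUinf hr (b := m 0 2) fun u hu => by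
    have := hm u hu 2
    rw [h₂₂, h₁₂] at this
    exact this.trans (by ring)
  obtain ⟨_, u, hu, -⟩ := hUinf.nonempty
  exact hα₁ u hu (by rw [hr u hu, hr₀, zero_mul])
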